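/- arXiv:1603.07371 — 3 statements merged into one kernel-verified Lean document; each statement's English description precedes it below -/
import Mathlib

section
/- Let C be a strong line cut of D, and let (S, T) be the associated S–T partition of the nodes of D. Then the partition is unidirectional: there is no edge (p, q) of D with p ∈ T and q ∈ S, i.e., every edge of D joining S and T is directed from a node of S to a node of T. -/
/-- `p` is a directed path in the digraph with edge relation `E`:
a nonempty list of pairwise distinct vertices with consecutive directed edges. -/
def IsDirPath {V : Type*} (E : V → V → Prop) (p : List V) : Prop :=
  p ≠ [] ∧ p.Chain' E ∧ p.Nodup

/-- `p` is a directed path from `a` to `b`. -/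
def IsDirPathFromTo {V : Type*} (E : V → V → Prop) (p : List V) (a b : V) : Prop :=
  IsDirPath E p ∧ p.head? = some a ∧ p.getLast? = some b

/-- A source is a node with no incoming edges. -/
def IsSourceNode {V : Type*} (E : V → V → Prop) (s : V) : Prop :=
  ∀ u, ¬ E u s

/-- The edge `e` lies on (is traversed by) the path `p`. -/
def EdgeOnPath {V : Type*} (p : List V) (e : V × V) : Prop :=
  [e.1, e.2] <:+: p

/-- `p` is a directed path from some source to the sink `v`. -/
def IsSourceToSinkPath {V : Type*} (E : V → V → Prop) (v : V) (p : List V) : Prop :=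
  ∃ s, IsSourceNode E s ∧ IsDirPathFromTo E p s v

/-- The digraph with edge relation `E` is acyclic: it has no directed cycle. -/
def IsAcyclicRel {V : Type*} (E : V → V → Prop) : Prop :=
  ∀ x, ¬ Relation.TransGen E x x

/-- `C` is a set of edges of the digraph that intersects
every directed path from a source to `v`. -/
def IsCutSet {V : Type*} (E : V → V → Prop) (v : V) (C : Set (V × V)) : Prop :=
  (∀ e ∈ C, E e.1 e.2) ∧ ∀ p, IsSourceToSinkPath E v p → ∃ e ∈ C, EdgeOnPath p e

/-- A line cut is a minimal set of edges intersecting every directed path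
from a source to `v`. -/
def IsLineCut {V : Type*} (E : V → V → Prop) (v : V) (C : Set (V × V)) : Prop :=
  IsCutSet E v C ∧ ∀ C', C' ⊂ C → ¬ IsCutSet E v C'

/-- The edges `e1` and `e2` lie on a common directed path of the digraph. -/
def OnCommonDirPath {V : Type*} (E : V → V → Prop) (e1 e2 : V × V) : Prop :=
  ∃ p, IsDirPath E p ∧ EdgeOnPath p e1 ∧ EdgeOnPath p e2

/-- The edges `e1` and `e2` lie on a common directed path from a source to `v`. -/
def OnCommonSourcePath {V : Type*} (E : V → V → Prop) (v : V) (e1 e2 : V × V) : Prop :=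
  ∃ p, IsSourceToSinkPath E v p ∧ EdgeOnPath p e1 ∧ EdgeOnPath p e2

/-- A strong line cut: a line cut no two of whose edges lie on a common
directed path of the digraph. -/
def IsStrongLineCut {V : Type*} (E : V → V → Prop) (v : V) (C : Set (V × V)) : Prop :=
  IsLineCut E v C ∧ ∀ e1 ∈ C, ∀ e2 ∈ C, e1 ≠ e2 → ¬ OnCommonDirPath E e1 e2

/-- `u` belongs to the set `T` of the S–T partition associated with the cut `C`:
`v` is reachable from `u` by a directed path that traverses no edge of `C`. -/
def ReachesSinkAvoiding {V : Type*} (E : V → V → Prop) (v : V) (C : Set (V × V))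
    (u : V) : Prop :=
  ∃ p, IsDirPathFromTo E p u v ∧ ∀ e : V × V, EdgeOnPath p e → e ∉ C

theorem IsAcyclicRel.nodup_of_isChain {V : Type*} {E : V → V → Prop} (h : IsAcyclicRel E)
    {l : List V} (hl : l.IsChain E) : l.Nodup := by
  have hT : l.IsChain (Relation.TransGen E) := hl.imp fun _ _ hab => .single hab
  refine (List.isChain_iff_pairwise.1 hT).imp fun {a b} hab heq => ?_
  exact h a (heq ▸ hab)

theorem IsAcyclicRel.exists_chain_from_source {V : Type*} [Finite V] {E : V → V → Prop}
    (h : IsAcyclicRel E) (x : V) :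
    ∃ s l, IsSourceNode E s ∧ (l ++ [x]).IsChain E ∧ (l ++ [x]).head? = some s := by
  have : Std.Irrefl (Relation.TransGen E) := ⟨h⟩
  induction x using (Finite.wellFounded_of_trans_of_irrefl (Relation.TransGen E)).induction with
  | _ x ih =>
    by_cases hx : IsSourceNode E x
    · exact ⟨x, [], hx, by simp, by simp⟩
    · obtain ⟨u, hu⟩ : ∃ u, E u x := by simpa [IsSourceNode] using hx
      obtain ⟨s, l, hs, hl, hhead⟩ := ih u (.single hu)
      refine ⟨s, l ++ [u], hs, ?_, ?_⟩
      · exact hl.append (by simp) (by simpa using hu)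
      · rw [List.head?_append, hhead, Option.some_or]

theorem EdgeOnPath.split {V : Type*} {x : V} {e : V × V} {l t : List V}
    (h : EdgeOnPath (l ++ x :: t) e) : EdgeOnPath (l ++ [x]) e ∨ EdgeOnPath (x :: t) e := by
  unfold EdgeOnPath at *
  induction l with
  | nil => exact .inr h
  | cons y l ih =>
    rw [List.cons_append, List.infix_cons_iff] at h ⊢
    rcases h with h | h
    · left; left
      cases l <;> simp_all [List.cons_prefix_cons]
    · rcases ih h with h | h
      · exact .inl (.inr h)
      · exact .inr h

/-- Let `C` be a strong line cut of the finite DAG `D` (the transitive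
fan-in cone of `v`) and let `(S, T)` be the associated S–T partition of the nodes
(`T` = nodes from which `v` is reachable avoiding edges of `C`, `S` = the rest).
Then the partition is unidirectional: there is no edge `(p, q)` of `D` with
`p ∈ T` and `q ∈ S`; every crossing edge goes from `S` to `T`. -/
theorem strong_line_cut_partition_unidirectional
    {V : Type*} [Fintype V] (E : V → V → Prop) (v : V)
    (hacyc : IsAcyclicRel E)
    (hcone : ∀ u : V, ∃ p, IsDirPathFromTo E p u v)
    (C : Set (V × V)) (hC : IsStrongLineCut E v C) :
    ¬ ∃ p q : V, E p q ∧ ReachesSinkAvoiding E v C p ∧ ¬ ReachesSinkAvoiding E v C q := by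
  rintro ⟨p, q, hpq, ⟨t, ⟨⟨-, htc, -⟩, hth, htl⟩, htC⟩, hq⟩
  obtain ⟨s, l, hs, hl, hhead⟩ := hacyc.exists_chain_from_source p
  obtain ⟨r, hr⟩ := hcone q
  obtain ⟨e₂, hre₂, he₂⟩ : ∃ e, EdgeOnPath r e ∧ e ∈ C := by
    by_contra! hcon
    exact hq ⟨r, hr, hcon⟩
  obtain ⟨⟨-, hrc, -⟩, hrh, -⟩ := hr
  obtain ⟨t, rfl⟩ : ∃ t', t = p :: t' := ⟨_, List.eq_cons_of_mem_head? hth⟩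
  have hlt : (l ++ p :: t).IsChain E := List.isChain_split.2 ⟨hl, htc⟩
  obtain ⟨e₁, he₁, hlte₁⟩ := hC.1.1.2 (l ++ p :: t)
    ⟨s, hs, ⟨by simp, hlt, hacyc.nodup_of_isChain hlt⟩,
      by simpa [List.head?_append] using hhead, by simpa using htl⟩
  have hle₁ : EdgeOnPath (l ++ [p]) e₁ := hlte₁.split.resolve_right fun h => htC _ h he₁
  have hlr : ((l ++ [p]) ++ r).IsChain E := hl.append hrc (by simpa [hrh] using hpq)
  have hnd := hacyc.nodup_of_isChain hlr
  refine hC.2 e₁ he₁ e₂ he₂ ?_ ⟨_, ⟨by simp, hlr, hnd⟩,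
    hle₁.trans (List.prefix_append _ _).isInfix, hre₂.trans (List.suffix_append _ _).isInfix⟩
  rintro rfl
  exact (List.nodup_append'.1 hnd).2.2 (hle₁.subset List.mem_cons_self)
    (hre₂.subset List.mem_cons_self)
end

section
/- Let G be a finite simple graph on vertex set V and let k be a natural number. Let dl ⊆ V be a set of vertices such that every maximal independent set of G containing a vertex of dl has cardinality greater than k. Let el be a set of unordered pairs {u, w} of distinct vertices of G with u, w ∉ dl, u and w non-adjacent in G, and such that every maximal independent set of G containing both u and w has cardinality greater than k. Let G' be the graph on vertex set V \ dl whose edge set consists of the edges of G between vertices of V \ dl together with the pairs in el. Then every maximal independent set S of G with |S| ≤ k is a maximal independent set of G'. -/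
/-- `S` is an independent set with respect to the adjacency relation `A`:
no two of its vertices are adjacent. -/
def IndepRel {V : Type*} (A : V → V → Prop) (S : Set V) : Prop :=
  ∀ u ∈ S, ∀ w ∈ S, ¬ A u w

/-- `S` is a maximal independent set of the graph with adjacency relation `A`
on the vertex set `W`: `S ⊆ W`, `S` is independent, and `S` is not properly
contained in any independent subset of `W`. -/
def MaxIndepOn {V : Type*} (A : V → V → Prop) (W S : Set V) : Prop :=
  S ⊆ W ∧ IndepRel A S ∧ ∀ T : Set V, T ⊆ W → IndepRel A T → S ⊆ T → T = S

/-- `S` is a maximal independent set of the simple graph `G`. -/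
def IsMIS {V : Type*} (G : SimpleGraph V) (S : Set V) : Prop :=
  MaxIndepOn G.Adj Set.univ S

/-- Theorem 1, pruning preserves small MISs: Let `G` be a finite
simple graph on `V` and `k : ℕ`. Let `dl ⊆ V` consist of vertices every MIS of
`G` containing one of which has cardinality `> k`. Let `el` be a set of unordered
pairs (a symmetric relation) of distinct, non-adjacent vertices outside `dl` such
that every MIS of `G` containing both has cardinality `> k`. Let `G'` be the graph
on `V \ dl` whose edges are the `G`-edges between vertices of `V \ dl` together
with the pairs of `el`. Then every MIS `S` of `G` with `|S| ≤ k` is an MIS of `G'`. -/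
theorem small_MIS_preserved_by_pruning
    {V : Type*} [Fintype V] (G : SimpleGraph V) (k : ℕ)
    (dl : Set V)
    (hdl : ∀ S : Set V, IsMIS G S → (∃ u ∈ dl, u ∈ S) → k < S.ncard)
    (el : V → V → Prop) (hel_symm : ∀ u w, el u w → el w u)
    (hel : ∀ u w, el u w → u ≠ w ∧ u ∉ dl ∧ w ∉ dl ∧ ¬ G.Adj u w ∧
      ∀ S : Set V, IsMIS G S → u ∈ S → w ∈ S → k < S.ncard)
    (S : Set V) (hS : IsMIS G S) (hcard : S.ncard ≤ k) :
    MaxIndepOn (fun u w => (u ∉ dl ∧ w ∉ dl ∧ G.Adj u w) ∨ el u w) dlᶜ S := by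
  refine ⟨fun u hu hd => hcard.not_gt (hdl S hS ⟨u, hd, hu⟩), ?_, ?_⟩
  · rintro u hu w hw (⟨-, -, huw⟩ | huw)
    · exact hS.2.1 u hu w hw huw
    · exact hcard.not_gt ((hel u w huw).2.2.2.2 S hS hu hw)
  · intro T hT hTi hST
    exact hS.2.2 T (Set.subset_univ T)
      (fun u hu w hw huw => hTi u hu w hw (Or.inl ⟨hT hu, hT hw, huw⟩)) hST
end

section
/- Let G be a finite simple graph, let u be a vertex of G, and let N[u] denote the closed neighborhood of u (u together with its neighbors). A set S of vertices with u ∈ S is a maximal independent set of G if and only if S \ {u} is a maximal independent set of the induced subgraph of G on the vertices outside N[u]. -/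
/-- Adding a vertex `u` to an independent set avoiding its closed neighborhood
keeps the set independent. -/
theorem IndepRel.insert_of_subset_compl {V : Type*} {G : SimpleGraph V} {u : V} {T : Set V}
    (hT : IndepRel G.Adj T) (hsub : T ⊆ (insert u (G.neighborSet u))ᶜ) :
    IndepRel G.Adj (insert u T) := by
  rintro a (rfl | ha) b (rfl | hb) hab
  · exact G.irrefl hab
  · exact hsub hb (Or.inr hab)
  · exact hsub ha (Or.inr hab.symm)
  · exact hT a ha b hb hab

/-- An independent set containing `u` meets the closed neighborhood of `u` only in `u`. -/
theorem IndepRel.sdiff_singleton_subset {V : Type*} {G : SimpleGraph V} {u : V} {T : Set V}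
    (hT : IndepRel G.Adj T) (hu : u ∈ T) : T \ {u} ⊆ (insert u (G.neighborSet u))ᶜ := by
  rintro a ⟨ha, hau⟩ (h | h)
  · exact hau h
  · exact hT u hu a ha h

theorem IndepRel.mono {V : Type*} {A : V → V → Prop} {S T : Set V}
    (hT : IndepRel A T) (hST : S ⊆ T) : IndepRel A S :=
  fun a ha b hb => hT a (hST ha) b (hST hb)

/-- Let `G` be a finite simple graph, `u` a vertex, and `N[u]` its
closed neighborhood. A set `S` of vertices with `u ∈ S` is a maximal independent
set of `G` if and only if `S \ {u}` is a maximal independent set of the induced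
subgraph of `G` on the vertices outside `N[u]`. -/
theorem MIS_containing_vertex_iff
    {V : Type*} [Fintype V] (G : SimpleGraph V) (u : V)
    (S : Set V) (hu : u ∈ S) :
    IsMIS G S ↔ MaxIndepOn G.Adj (insert u (G.neighborSet u))ᶜ (S \ {u}) := by
  constructor
  · rintro ⟨-, hS, hmax⟩
    refine ⟨hS.sdiff_singleton_subset hu, hS.mono Set.sdiff_subset, fun T hTW hT hST => ?_⟩
    have huT : u ∉ T := fun h => hTW h (Set.mem_insert _ _)
    rw [← hmax (insert u T) (Set.subset_univ _) (hT.insert_of_subset_compl hTW)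
      (Set.sdiff_singleton_subset_iff.mp hST), Set.insert_sdiff_self_of_notMem huT]
  · rintro ⟨hsub, hS, hmax⟩
    refine ⟨Set.subset_univ _, ?_, fun T _ hT hST => ?_⟩
    · simpa [Set.insert_eq_of_mem hu] using hS.insert_of_subset_compl hsub
    · have h := hmax (T \ {u}) (hT.sdiff_singleton_subset (hST hu)) (hT.mono Set.sdiff_subset)
        (Set.sdiff_subset_sdiff_left hST)
      rw [← Set.insert_sdiff_self_of_mem (hST hu), h, Set.insert_sdiff_self_of_mem hu]
end
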